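/- For all alternating maps A ∈ A^a(V), B ∈ A^b(V) and every multiderivation C ∈ ADer^c(V) one has the insertion identity i_{A∧B}C = (−1)^{c(b+1)}(i_A C)∧B + A∧(i_B C). -/

import Mathlib

/-!  Common framework: operations of degree `a ≥ -1` on a vector space `V`
(i.e. `(a+1)`-linear maps `V^{a+1} → V`) are encoded as raw functions
`(ℕ → V) → V` depending only on the first `a+1` entries of the argument
sequence, together with explicit multilinearity/alternation predicates. -/

noncomputable section
open scoped Classical

namespace JacobiRevisited

/-- Raw operations on `V`: an `n`-ary operation is encoded by its action on
infinite sequences of arguments (using only the first `n` of them). -/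
abbrev Op (V : Type*) := (ℕ → V) → V

/-- `A` depends only on the first `n` arguments. -/
def DependsOn {V : Type*} (n : ℕ) (A : Op V) : Prop :=
  ∀ x y : ℕ → V, (∀ i, i < n → x i = y i) → A x = A y

/-- `A` is an `n`-linear map `V^n → V` (encoded on sequences): it depends only on
the first `n` arguments and is `k`-linear in each of them. -/
def IsMultilinearOn (k : Type*) {V : Type*} [Semiring k] [AddCommMonoid V]
    [Module k V] (n : ℕ) (A : Op V) : Prop :=
  DependsOn n A ∧
    ∀ i, i < n →
      (∀ (x : ℕ → V) (c : k) (v : V),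
        A (Function.update x i (c • v)) = c • A (Function.update x i v)) ∧
      (∀ (x : ℕ → V) (v w : V),
        A (Function.update x i (v + w)) =
          A (Function.update x i v) + A (Function.update x i w))

/-- `A` is alternating in its first `n` arguments. -/
def IsAlternatingOn {V : Type*} [Zero V] (n : ℕ) (A : Op V) : Prop :=
  ∀ x : ℕ → V, ∀ i j, i < n → j < n → i ≠ j → x i = x j → A x = 0

/-- The number of arguments of an operation of degree `a` (namely `a+1`). -/
def ar (a : ℤ) : ℕ := (a + 1).toNat

/-- Membership in `M^a(V)`: an `(a+1)`-linear map `V^{a+1} → V`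
(for `a = -1` this is just a constant, i.e. an element of `V`). -/
def MemM (k : Type*) {V : Type*} [Semiring k] [AddCommMonoid V] [Module k V]
    (a : ℤ) (A : Op V) : Prop := IsMultilinearOn k (ar a) A

/-- Membership in `A^a(V)`: an alternating `(a+1)`-linear map `V^{a+1} → V`. -/
def MemA (k : Type*) {V : Type*} [Semiring k] [AddCommMonoid V] [Module k V]
    (a : ℤ) (A : Op V) : Prop :=
  IsMultilinearOn k (ar a) A ∧ IsAlternatingOn (ar a) A

/-- The argument sequence `x_0, …, x_{m-1}, B(x_m,…,x_{m+nB-1}), x_{m+nB}, …`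
(arguments for the outer operation after inserting the `nB`-ary `B`
at slot `m`). -/
def insertArg {V : Type*} (B : Op V) (nB m : ℕ) (x : ℕ → V) : ℕ → V := fun j =>
  if j < m then x j
  else if j = m then B fun i => x (m + i)
  else x (j + nB - 1)

/-- The Gerstenhaber insertion `ι_B A` of `B ∈ M^b(V)` into `A ∈ M^a(V)`:
`ι_B A(x_0,…,x_{a+b}) = Σ_{m=0}^{a} (−1)^{b·m} A(x_0,…,x_{m−1},
B(x_m,…,x_{m+b}), x_{m+b+1},…,x_{a+b})`. -/
def gIns {V : Type*} [AddCommGroup V] (a b : ℤ) (A B : Op V) : Op V := fun x =>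
  ∑ m ∈ Finset.range (ar a),
    (((-1 : ℤˣ) ^ (b * (m : ℤ)) : ℤˣ) : ℤ) • A (insertArg B (ar b) m x)

/-- The Gerstenhaber bracket `[A,B]^G = −ι_A B + (−1)^{ab} ι_B A` of
`A ∈ M^a(V)` and `B ∈ M^b(V)`. -/
def gBracket {V : Type*} [AddCommGroup V] (a b : ℤ) (A B : Op V) : Op V :=
  -(gIns b a B A) + (((-1 : ℤˣ) ^ (a * b) : ℤˣ) : ℤ) • gIns a b A B

/-- The set `S(n-1, p-1)` of unshuffle permutations of `{0,…,n-1}` which are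
strictly increasing on the first `p` positions and on the remaining ones. -/
def Unshuffles (n p : ℕ) : Finset (Equiv.Perm (Fin n)) :=
  Finset.univ.filter fun σ =>
    (∀ i j : Fin n, (i : ℕ) < (j : ℕ) → (j : ℕ) < p → σ i < σ j) ∧
    (∀ i j : Fin n, (i : ℕ) < (j : ℕ) → p ≤ (i : ℕ) → σ i < σ j)

/-- The Nijenhuis–Richardson insertion `i_B A` of the `nB`-ary `B` into the
`nA`-ary `A`:
`i_B A(x_0,…,x_{a+b}) = Σ_{σ ∈ S(a+b,b)} sgn(σ) ·
A(B(x_{σ(0)},…,x_{σ(b)}), x_{σ(b+1)},…,x_{σ(a+b)})`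
(and `i_B A = 0` when `A` has degree `-1`, i.e. no argument slots). -/
def nrIns {V : Type*} [AddCommGroup V] (nA nB : ℕ) (A B : Op V) : Op V := fun x =>
  if hA : nA = 0 then 0
  else
    ∑ σ ∈ Unshuffles (nA + nB - 1) nB,
      ((Equiv.Perm.sign σ : ℤˣ) : ℤ) •
        A fun j =>
          if hj0 : j = 0 then
            B fun i => if hi : i < nB then x (σ ⟨i, by omega⟩) else 0
          else if hj : j < nA then x (σ ⟨nB + j - 1, by omega⟩) else 0

/-- The Nijenhuis–Richardson bracket `[A,B]^{NR} = −i_A B + (−1)^{ab} i_B A`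
of `A ∈ A^a(V)` and `B ∈ A^b(V)`. -/
def nrBracket {V : Type*} [AddCommGroup V] (a b : ℤ) (A B : Op V) : Op V :=
  -(nrIns (ar b) (ar a) B A) +
    (((-1 : ℤˣ) ^ (a * b) : ℤˣ) : ℤ) • nrIns (ar a) (ar b) A B

/-- The wedge product `A∧B` of the `nA`-ary `A` and the `nB`-ary `B`
(over a commutative algebra `V`):
`(A∧B)(x_0,…,x_{a+b+1}) = Σ_σ sgn(σ) · A(x_{σ(0)},…,x_{σ(a)}) ·
B(x_{σ(a+1)},…,x_{σ(a+b+1)})` summed over unshuffles. -/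
def wedge {V : Type*} [CommRing V] (nA nB : ℕ) (A B : Op V) : Op V := fun x =>
  ∑ σ ∈ Unshuffles (nA + nB) nA,
    ((Equiv.Perm.sign σ : ℤˣ) : ℤ) •
      (A (fun i => if hi : i < nA then x (σ ⟨i, by omega⟩) else 0) *
        B fun j => if hj : j < nB then x (σ ⟨nA + j, by omega⟩) else 0)

/-- The argument sequence `v, x_0, x_1, …`. -/
def consV {V : Type*} (v : V) (x : ℕ → V) : ℕ → V := fun n =>
  if n = 0 then v else x (n - 1)

/-- The argument sequence `v, w, 0, 0, …` (for applying binary operations). -/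
def duo {V : Type*} [Zero V] (v w : V) : ℕ → V := fun n =>
  if n = 0 then v else if n = 1 then w else 0

/-- Membership in `ADer^a(V)`: an alternating `(a+1)`-linear map which (for
`a ≥ 0`) is a derivation in its first (hence, by skew-symmetry, in each)
argument; `ADer^{-1}(V) = V`. -/
def MemADer (k : Type*) {V : Type*} [CommRing k] [CommRing V] [Algebra k V]
    (a : ℤ) (A : Op V) : Prop :=
  IsMultilinearOn k (ar a) A ∧ IsAlternatingOn (ar a) A ∧
    (0 ≤ a → ∀ (f g : V) (x : ℕ → V),
      A (consV (f * g) x) = f * A (consV g x) + g * A (consV f x))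

/-- Membership in `ADiff_1^a(V)`: an alternating `(a+1)`-linear map which (for
`a ≥ 0`) is a first-order differential operator in its first (hence in each)
argument; `ADiff_1^{-1}(V) = V`. -/
def MemADiff1 (k : Type*) {V : Type*} [CommRing k] [CommRing V] [Algebra k V]
    (a : ℤ) (A : Op V) : Prop :=
  IsMultilinearOn k (ar a) A ∧ IsAlternatingOn (ar a) A ∧
    (0 ≤ a → ∀ (f g : V) (x : ℕ → V),
      A (consV (f * g) x) =
        f * A (consV g x) + g * A (consV f x) - f * g * A (consV 1 x))

/-- `D : V → V` is a differential operator of order `≤ n` on the commutative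
algebra `V`. -/
def DiffOrderLe {V : Type*} [CommRing V] : ℕ → (V → V) → Prop
  | 0 => fun D => ∀ f x, D (f * x) = f * D x
  | n + 1 => fun D => ∀ f : V, DiffOrderLe n fun x => D (f * x) - f * D x

/-- Membership in `ADiff^a(V)`: an alternating `(a+1)`-linear map which is a
differential operator of some finite order in each argument separately
(the other arguments being fixed); `ADiff^{-1}(V) = V`. -/
def MemADiff (k : Type*) {V : Type*} [CommRing k] [CommRing V] [Algebra k V]
    (a : ℤ) (A : Op V) : Prop :=
  IsMultilinearOn k (ar a) A ∧ IsAlternatingOn (ar a) A ∧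
    ∀ i, i < ar a → ∃ n, ∀ x : ℕ → V,
      DiffOrderLe n fun v => A (Function.update x i v)

/-- The identity map `I ∈ A^0(V)`. -/
def Iop {V : Type*} : Op V := fun x => x 0

/-- The insertion `i_1 A` of the unit `1 ∈ V = A^{-1}(V)` into `A ∈ A^a(V)`;
for `a ≥ 0` this is `A(1,·,…,·)`. -/
def iUnit {V : Type*} [CommRing V] (a : ℤ) (A : Op V) : Op V :=
  nrIns (ar a) 0 A fun _ => 1

/-- Application of a degree-0 (i.e. unary) operation to an element of `V`. -/
def app1 {V : Type*} (X : Op V) (v : V) : V := X fun _ => v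

/-- The commutator `X∘Y − Y∘X` of two degree-0 operations. -/
def commOp {V : Type*} [AddCommGroup V] (X Y : Op V) : Op V := fun x =>
  app1 X (app1 Y (x 0)) - app1 Y (app1 X (x 0))

/-- The iterated wedge product `X_1 ∧ … ∧ X_m` of a list of degree-0
operations (with the empty product being the unit `1 ∈ V = A^{-1}(V)`). -/
def wedgeList {V : Type*} [CommRing V] : List (Op V) → Op V
  | [] => fun _ => 1
  | X :: l => wedge 1 l.length X (wedgeList l)



open Equiv

/-- Permutations of `Fin N` that are increasing on each fibre of the colouring `c`. -/
def monoPerms {N : ℕ} (c : Fin N → ℕ) : Finset (Perm (Fin N)) :=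
  Finset.univ.filter fun σ => ∀ i j, i < j → c i = c j → σ i < σ j

theorem mem_monoPerms {N : ℕ} {c : Fin N → ℕ} {σ : Perm (Fin N)} :
    σ ∈ monoPerms c ↔ ∀ i j, i < j → c i = c j → σ i < σ j := by
  simp [monoPerms]

theorem unshuffles_eq_monoPerms (N p : ℕ) :
    Unshuffles N p = monoPerms fun i : Fin N => if (i : ℕ) < p then 0 else 1 := by
  ext σ
  simp only [Unshuffles, monoPerms, Finset.mem_filter, Finset.mem_univ, true_and]
  constructor
  · rintro ⟨h₁, h₂⟩ i j hij h
    have hij' : (i : ℕ) < j := hij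
    split_ifs at h with hi hj hj
    · exact h₁ i j hij hj
    · exact h₂ i j hij (not_lt.mp hi)
  · intro h
    refine ⟨fun i j hij hj => h i j hij ?_, fun i j hij hi => h i j hij ?_⟩
    · rw [if_pos (by omega), if_pos hj]
    · rw [if_neg (by omega), if_neg (by omega)]

theorem perm_eq_one_of_strictMono {n : ℕ} {ρ : Perm (Fin n)} (h : StrictMono ρ) : ρ = 1 := by
  have h' := Tuple.unique_monotone (f := (id : Fin n → Fin n)) (σ := ρ) (τ := 1)
    h.monotone monotone_id
  ext i
  exact congrArg Fin.val (congrFun h' i)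

/-- Refining the colouring `d` to `c` inside a single block, the image of `e`, amounts to
composing with the permutations of that block that are increasing for the induced colouring. -/
theorem sum_monoPerms_mul {M : Type*} [AddCommMonoid M] {N n : ℕ} (e : Fin n ↪o Fin N)
    {d c : Fin N → ℕ} {c' : Fin n → ℕ} (hde : ∀ i j, d (e i) = d (e j))
    (hout : ∀ i j, i ∉ Set.range e → d i = d j → j ∉ Set.range e ∧ c i = c j)
    (hcd : ∀ i j, c i = c j → d i = d j) (hce : ∀ i j, c (e i) = c (e j) ↔ c' i = c' j)
    (F : Perm (Fin N) → M) :
    ∑ σ ∈ monoPerms d, ∑ τ ∈ monoPerms c', F (σ * τ.viaFintypeEmbedding e.toEmbedding) =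
      ∑ π ∈ monoPerms c, F π := by
  have himg (τ : Perm (Fin n)) (i : Fin n) :
      τ.viaFintypeEmbedding e.toEmbedding (e i) = e (τ i) :=
    Perm.viaFintypeEmbedding_apply_image τ e.toEmbedding i
  have hfix (τ : Perm (Fin n)) (i : Fin N) (hi : i ∉ Set.range e) :
      τ.viaFintypeEmbedding e.toEmbedding i = i :=
    Perm.viaFintypeEmbedding_apply_notMem_range τ e.toEmbedding hi
  have hmul (σ τ : Perm (Fin n)) : (σ * τ).viaFintypeEmbedding e.toEmbedding =
      σ.viaFintypeEmbedding e.toEmbedding * τ.viaFintypeEmbedding e.toEmbedding := by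
    ext i
    by_cases hi : i ∈ Set.range e
    · obtain ⟨i, rfl⟩ := hi
      simp only [Perm.mul_apply, himg]
    · simp only [Perm.mul_apply, hfix _ _ hi]
  have hone : (1 : Perm (Fin n)).viaFintypeEmbedding e.toEmbedding = 1 := by
    ext i
    by_cases hi : i ∈ Set.range e
    · obtain ⟨i, rfl⟩ := hi
      simp only [himg, Perm.one_apply]
    · simp only [hfix _ _ hi, Perm.one_apply]
  have hmono {σ : Perm (Fin N)} (hσ : σ ∈ monoPerms d) : StrictMono (σ ∘ e) :=
    fun i j hij => mem_monoPerms.mp hσ _ _ (e.strictMono hij) (hde i j)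
  rw [← Finset.sum_product']
  refine Finset.sum_bij (fun s _ => s.1 * s.2.viaFintypeEmbedding e.toEmbedding) ?_ ?_ ?_
    fun _ _ => rfl
  · rintro ⟨σ, τ⟩ h
    obtain ⟨hσ, hτ⟩ := Finset.mem_product.mp h
    refine mem_monoPerms.mpr fun i j hij hc => ?_
    have hd := hcd i j hc
    by_cases hi : i ∈ Set.range e
    · have hj : j ∈ Set.range e := by
        by_contra hj
        exact (hout j i hj hd.symm).1 hi
      obtain ⟨i, rfl⟩ := hi
      obtain ⟨j, rfl⟩ := hj
      simp only [Perm.mul_apply, himg]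
      exact hmono hσ (mem_monoPerms.mp hτ _ _ (e.lt_iff_lt.mp hij) ((hce i j).mp hc))
    · have hj := (hout i j hi hd).1
      simp only [Perm.mul_apply, hfix _ _ hi, hfix _ _ hj]
      exact mem_monoPerms.mp hσ i j hij hd
  · rintro ⟨σ, τ⟩ h ⟨σ', τ'⟩ h' heq
    have hσ := hmono (Finset.mem_product.mp h).1
    have hσ' := hmono (Finset.mem_product.mp h').1
    dsimp only at heq hσ hσ'
    have hσσ' : σ' = σ * (τ * τ'⁻¹).viaFintypeEmbedding e.toEmbedding := by
      have hinv : τ'.viaFintypeEmbedding e.toEmbedding *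
          τ'⁻¹.viaFintypeEmbedding e.toEmbedding = 1 := by
        rw [← hmul, mul_inv_cancel, hone]
      rw [hmul, ← mul_assoc, heq, mul_assoc, hinv, mul_one]
    have hρ : τ * τ'⁻¹ = 1 := by
      refine perm_eq_one_of_strictMono fun i j hij => ?_
      have := hσ' hij
      rw [hσσ'] at this
      simp only [Function.comp_apply, Perm.mul_apply, himg] at this
      exact hσ.lt_iff_lt.mp this
    have hτ : τ = τ' := mul_inv_eq_one.mp hρ
    rw [hρ, hone, mul_one] at hσσ'
    rw [hσσ', hτ]
  · intro π hπ
    have hπ := mem_monoPerms.mp hπ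
    set ρ := Tuple.sort (π ∘ e)
    have hsort : StrictMono ((π ∘ e) ∘ ρ) :=
      (Tuple.monotone_sort (π ∘ e)).strictMono_of_injective
        ((π.injective.comp e.injective).comp ρ.injective)
    refine ⟨(π * ρ.viaFintypeEmbedding e.toEmbedding, ρ⁻¹), ?_, ?_⟩
    · refine Finset.mem_product.mpr ⟨mem_monoPerms.mpr fun i j hij hd => ?_,
        mem_monoPerms.mpr fun i j hij hc => ?_⟩
      · by_cases hi : i ∈ Set.range e
        · have hj : j ∈ Set.range e := by
            by_contra hj
            exact (hout j i hj hd.symm).1 hi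
          obtain ⟨i, rfl⟩ := hi
          obtain ⟨j, rfl⟩ := hj
          simp only [Perm.mul_apply, himg]
          exact hsort (e.lt_iff_lt.mp hij)
        · obtain ⟨hj, hc⟩ := hout i j hi hd
          simp only [Perm.mul_apply, hfix _ _ hi, hfix _ _ hj]
          exact hπ i j hij hc
      · refine hsort.lt_iff_lt.mp ?_
        simpa using hπ _ _ (e.strictMono hij) ((hce i j).mpr hc)
    · dsimp only
      rw [mul_assoc, ← hmul, mul_inv_cancel, hone, mul_one]

/-- The interval of length `n` starting at `s`, as an order embedding into `Fin N`. -/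
def block (s n N : ℕ) (h : s + n ≤ N) : Fin n ↪o Fin N :=
  OrderEmbedding.ofStrictMono (fun i => ⟨s + i, by omega⟩) fun i j hij => by
    have : (i : ℕ) < j := hij
    exact Fin.mk_lt_mk.mpr (by omega)

@[simp] theorem block_val (s n N : ℕ) (h : s + n ≤ N) (i : Fin n) :
    (block s n N h i : ℕ) = s + i := rfl

theorem mem_range_block {s n N : ℕ} {h : s + n ≤ N} {i : Fin N} :
    i ∈ Set.range (block s n N h) ↔ s ≤ i ∧ (i : ℕ) < s + n := by
  constructor
  · rintro ⟨j, rfl⟩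
    simp
  · rintro ⟨h₁, h₂⟩
    exact ⟨⟨i - s, by omega⟩, Fin.ext (by simp; omega)⟩

/-- A permutation of `Fin n` acting on the interval of length `n` starting at `s`. -/
def blockPerm {n : ℕ} (s N : ℕ) (h : s + n ≤ N) (τ : Perm (Fin n)) : Perm (Fin N) :=
  τ.viaFintypeEmbedding (block s n N h).toEmbedding

theorem blockPerm_of_mem {n s N : ℕ} (h : s + n ≤ N) (τ : Perm (Fin n)) {i : ℕ} (hi : i < n)
    (hi' : s + i < N) : (blockPerm s N h τ ⟨s + i, hi'⟩ : ℕ) = s + τ ⟨i, hi⟩ :=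
  congrArg Fin.val
    (Perm.viaFintypeEmbedding_apply_image τ (block s n N h).toEmbedding ⟨i, hi⟩)

theorem blockPerm_of_notMem {n s N : ℕ} (h : s + n ≤ N) (τ : Perm (Fin n)) {i : Fin N}
    (hi : ¬(s ≤ i ∧ (i : ℕ) < s + n)) : blockPerm s N h τ i = i :=
  Perm.viaFintypeEmbedding_apply_notMem_range τ (block s n N h).toEmbedding
    (mt mem_range_block.mp hi)

@[simp] theorem sign_blockPerm {n s N : ℕ} (h : s + n ≤ N) (τ : Perm (Fin n)) :
    Perm.sign (blockPerm s N h τ) = Perm.sign τ :=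
  Perm.viaFintypeEmbedding_sign τ _

/-- The colouring of `Fin N` by the intervals `[0, p)`, `[p, r)` and `[r, N)`. -/
def threeBlocks (N p r : ℕ) (i : Fin N) : ℕ :=
  if (i : ℕ) < p then 0 else if (i : ℕ) < r then 1 else 2

theorem sum_unshuffles_mul_left {M : Type*} [AddCommMonoid M] {N p r : ℕ} (hp : p ≤ r)
    (hr : 0 + r ≤ N) (F : Perm (Fin N) → M) :
    ∑ σ ∈ Unshuffles N r, ∑ τ ∈ Unshuffles r p, F (σ * blockPerm 0 N hr τ) =
      ∑ π ∈ monoPerms (threeBlocks N p r), F π := by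
  rw [unshuffles_eq_monoPerms, unshuffles_eq_monoPerms]
  refine sum_monoPerms_mul (block 0 r N hr) ?_ ?_ ?_ ?_ F
  · intro i j
    simp
  · intro i j
    rw [mem_range_block, mem_range_block]
    unfold threeBlocks
    grind
  · intro i j
    unfold threeBlocks
    grind
  · intro i j
    simp only [threeBlocks, block_val]
    grind

theorem sum_unshuffles_mul_right {M : Type*} [AddCommMonoid M] {N p q n : ℕ}
    (hN : p + n = N) (F : Perm (Fin N) → M) :
    ∑ σ ∈ Unshuffles N p, ∑ τ ∈ Unshuffles n q, F (σ * blockPerm p N hN.le τ) =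
      ∑ π ∈ monoPerms (threeBlocks N p (p + q)), F π := by
  rw [unshuffles_eq_monoPerms, unshuffles_eq_monoPerms]
  refine sum_monoPerms_mul (block p n N hN.le) ?_ ?_ ?_ ?_ F
  · intro i j
    simp
  · intro i j
    rw [mem_range_block, mem_range_block]
    unfold threeBlocks
    grind
  · intro i j
    unfold threeBlocks
    grind
  · intro i j
    simp only [threeBlocks, block_val]
    grind

theorem finRotate_pow_apply {n m : ℕ} (i : Fin n) (hm : m ≤ n) :
    ((finRotate n ^ m) i : ℕ) = if (i : ℕ) + m < n then (i : ℕ) + m else i + m - n := by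
  induction m with
  | zero => simp
  | succ m ih =>
    obtain ⟨n, rfl⟩ : ∃ t, n = t + 1 := ⟨n - 1, by omega⟩
    have ih := ih (by omega)
    rw [pow_succ', Perm.mul_apply, coe_finRotate]
    simp only [Fin.ext_iff, ih, Fin.val_last]
    grind

theorem sign_finRotate_pow (q m : ℕ) :
    Perm.sign (finRotate (q + m) ^ m) = (-1) ^ (m * q) := by
  rcases m with _ | m
  · simp
  · rw [map_pow, ← add_assoc, sign_finRotate, Nat.add_sub_cancel, ← pow_mul]
    have h : (q + m) * (m + 1) = (m + 1) * q + m * (m + 1) := by ring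
    rw [h, pow_add, (Nat.even_mul_succ_self m).neg_one_pow, mul_one]

/-- The permutation moving the block `[p, p + q)` past the following `m` positions. -/
def blockSwap (p q m N : ℕ) (h : p + (q + m) ≤ N) : Perm (Fin N) :=
  blockPerm p N h (finRotate (q + m) ^ m)

theorem blockSwap_apply {p q m N : ℕ} (h : p + (q + m) = N) (i : Fin N) :
    (blockSwap p q m N h.le i : ℕ) =
      if (i : ℕ) < p then (i : ℕ) else if (i : ℕ) < p + q then (i : ℕ) + m else i - q := by
  by_cases hi : (i : ℕ) < p
  · rw [if_pos hi, blockSwap, blockPerm_of_notMem _ _ (by omega)]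
  · obtain ⟨i, hiN⟩ := i
    obtain ⟨j, rfl⟩ : ∃ j, i = p + j := ⟨i - p, by simp at hi; omega⟩
    rw [blockSwap, blockPerm_of_mem _ _ (by omega : j < q + m), finRotate_pow_apply _ (by omega)]
    grind

theorem sum_monoPerms_blockSwap {M : Type*} [AddCommMonoid M] {p q m N : ℕ}
    (h : p + (q + m) = N) (F : Perm (Fin N) → M) :
    ∑ π ∈ monoPerms (threeBlocks N p (p + m)), F (π * blockSwap p q m N h.le) =
      ∑ π ∈ monoPerms (threeBlocks N p (p + q)), F π := by
  have key (i j : Fin N) (hc : threeBlocks N p (p + q) i = threeBlocks N p (p + q) j) :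
      (blockSwap p q m N h.le i < blockSwap p q m N h.le j ↔ i < j) ∧
      threeBlocks N p (p + m) (blockSwap p q m N h.le i) =
        threeBlocks N p (p + m) (blockSwap p q m N h.le j) := by
    simp only [Fin.lt_def, threeBlocks, blockSwap_apply h] at hc ⊢
    grind
  have key' (i j : Fin N) (hc : threeBlocks N p (p + m) (blockSwap p q m N h.le i) =
        threeBlocks N p (p + m) (blockSwap p q m N h.le j)) :
      threeBlocks N p (p + q) i = threeBlocks N p (p + q) j := by
    simp only [threeBlocks, blockSwap_apply h] at hc ⊢
    grind
  refine Finset.sum_equiv (Equiv.mulRight (blockSwap p q m N h.le)) (fun π => ?_)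
    fun _ _ => rfl
  rw [mem_monoPerms, mem_monoPerms]
  constructor
  · intro hπ i j hij hc
    exact hπ _ _ ((key i j hc).1.mpr hij) (key i j hc).2
  · intro hπ i j hij hc
    obtain ⟨i, rfl⟩ := (blockSwap p q m N h.le).surjective i
    obtain ⟨j, rfl⟩ := (blockSwap p q m N h.le).surjective j
    have hc' := key' i j hc
    exact hπ i j ((key i j hc').1.mp hij) hc'

/-- The argument sequence `x_{σ(0)}, …, x_{σ(N-1)}, 0, 0, …`. -/
def permArgs {V : Type*} [Zero V] {N : ℕ} (x : ℕ → V) (σ : Perm (Fin N)) : ℕ → V := fun i =>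
  if h : i < N then x (σ ⟨i, h⟩) else 0

theorem permArgs_congr {V : Type*} [Zero V] {N : ℕ} {x y : ℕ → V} (h : ∀ i, i < N → x i = y i)
    (σ : Perm (Fin N)) : permArgs x σ = permArgs y σ := by
  funext i
  simp only [permArgs]
  split_ifs with hi
  · exact h _ (σ ⟨i, hi⟩).isLt
  · rfl

theorem permArgs_mul {V : Type*} [Zero V] {N : ℕ} (x : ℕ → V) (σ ρ : Perm (Fin N)) {i j : ℕ}
    (hi : i < N) (hj : (ρ ⟨i, hi⟩ : ℕ) = j) : permArgs x (σ * ρ) i = permArgs x σ j := by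
  subst hj
  simp [permArgs, hi]

theorem permArgs_mul_blockPerm {V : Type*} [Zero V] {N n s : ℕ} (h : s + n ≤ N) (x : ℕ → V)
    (σ : Perm (Fin N)) (τ : Perm (Fin n)) {i : ℕ} (hi : i < n) :
    permArgs x (σ * blockPerm s N h τ) (s + i) =
      permArgs (fun j => permArgs x σ (s + j)) τ i := by
  rw [permArgs_mul x σ _ (by omega) (blockPerm_of_mem h τ hi (by omega))]
  simp [permArgs, hi]

theorem permArgs_mul_blockPerm_of_notMem {V : Type*} [Zero V] {N n s : ℕ} (h : s + n ≤ N)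
    (x : ℕ → V) (σ : Perm (Fin N)) (τ : Perm (Fin n)) {i : ℕ} (hi : ¬(s ≤ i ∧ i < s + n)) :
    permArgs x (σ * blockPerm s N h τ) i = permArgs x σ i := by
  by_cases hiN : i < N
  · exact permArgs_mul x σ _ hiN (congrArg Fin.val (blockPerm_of_notMem h τ hi))
  · simp [permArgs, hiN]

theorem consV_congr {V : Type*} {m : ℕ} {C : Op V} (hC : DependsOn (m + 1) C) {v w : V} {x y : ℕ → V}
    (hv : v = w) (h : ∀ i, i < m → x i = y i) : C (consV v x) = C (consV w y) := by
  subst hv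
  refine hC _ _ fun i hi => ?_
  rcases i with _ | i
  · rfl
  · exact h i (by omega)

theorem update_consV {V : Type*} (u v : V) (x : ℕ → V) : Function.update (consV u x) 0 v = consV v x := by
  funext i
  rcases i with _ | i <;> simp [consV]

section Operations

variable {V : Type*} [CommRing V]

theorem wedge_apply {p q N : ℕ} (hN : p + q = N) {A B : Op V} (hA : DependsOn p A)
    (hB : DependsOn q B) (x : ℕ → V) :
    wedge p q A B x = ∑ σ ∈ Unshuffles N p, ((Perm.sign σ : ℤˣ) : ℤ) •
      (A (permArgs x σ) * B fun j => permArgs x σ (p + j)) := by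
  subst hN
  refine Finset.sum_congr rfl fun σ _ => ?_
  congr 2
  · refine hA _ _ fun i hi => ?_
    simp only [permArgs]
    rw [dif_pos hi, dif_pos (by omega)]
  · refine hB _ _ fun i hi => ?_
    simp only [permArgs]
    rw [dif_pos hi, dif_pos (by omega)]

theorem nrIns_apply {m q N : ℕ} (hN : q + m = N) {C B : Op V} (hC : DependsOn (m + 1) C)
    (hB : DependsOn q B) (x : ℕ → V) :
    nrIns (m + 1) q C B x = ∑ σ ∈ Unshuffles N q, ((Perm.sign σ : ℤˣ) : ℤ) •
      C (consV (B (permArgs x σ)) fun j => permArgs x σ (q + j)) := by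
  obtain rfl : N = m + 1 + q - 1 := by omega
  simp only [nrIns]
  rw [dif_neg (by omega)]
  refine Finset.sum_congr rfl fun σ _ => ?_
  congr 1
  refine hC _ _ fun i hi => ?_
  rcases i with _ | i
  · simp only [consV, dif_pos, if_pos]
    refine hB _ _ fun i hi => ?_
    simp only [permArgs]
    rw [dif_pos hi, dif_pos (by omega)]
  · simp only [consV, permArgs]
    rw [dif_neg (by omega), dif_pos hi, if_neg (by omega), dif_pos (by omega)]
    rfl

theorem wedge_dependsOn {p q : ℕ} {A B : Op V} (hA : DependsOn p A) (hB : DependsOn q B) :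
    DependsOn (p + q) (wedge p q A B) := fun x y h => by
  simp only [wedge_apply rfl hA hB, permArgs_congr h]

theorem nrIns_dependsOn {m q : ℕ} {C B : Op V} (hC : DependsOn (m + 1) C)
    (hB : DependsOn q B) : DependsOn (q + m) (nrIns (m + 1) q C B) := fun x y h => by
  simp only [nrIns_apply rfl hC hB, permArgs_congr h]

/-- A multilinear operation as an additive map in its first argument. -/
def firstArgHom {k : Type*} [Semiring k] [Module k V] {m : ℕ} {C : Op V}
    (hC : IsMultilinearOn k (m + 1) C) (x : ℕ → V) : V →+ V :=
  AddMonoidHom.mk' (fun v => C (consV v x)) fun v w => by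
    simpa only [update_consV] using (hC.2 0 m.succ_pos).2 (consV 0 x) v w

theorem firstArgHom_apply {k : Type*} [Semiring k] [Module k V] {m : ℕ} {C : Op V}
    (hC : IsMultilinearOn k (m + 1) C) (x : ℕ → V) (v : V) :
    firstArgHom hC x v = C (consV v x) := rfl

theorem nrIns_wedge_apply {k : Type*} [Semiring k] [Module k V] {p q m N : ℕ}
    (hN : p + (q + m) = N) {A B C : Op V} (hA : DependsOn p A) (hB : DependsOn q B)
    (hC : IsMultilinearOn k (m + 1) C) (x : ℕ → V) :
    nrIns (m + 1) (p + q) C (wedge p q A B) x =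
      ∑ π ∈ monoPerms (threeBlocks N p (p + q)), ((Perm.sign π : ℤˣ) : ℤ) •
        C (consV (A (permArgs x π) * B fun j => permArgs x π (p + j))
          fun j => permArgs x π (p + q + j)) := by
  rw [nrIns_apply (N := N) (by omega) hC.1 (wedge_dependsOn hA hB),
    ← sum_unshuffles_mul_left (by omega) (by omega)]
  refine Finset.sum_congr rfl fun σ _ => ?_
  rw [wedge_apply rfl hA hB, ← firstArgHom_apply hC, map_sum, Finset.smul_sum]
  refine Finset.sum_congr rfl fun τ _ => ?_
  rw [map_zsmul, smul_smul, Perm.sign_mul, sign_blockPerm, Units.val_mul, firstArgHom_apply]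
  congr 1
  have hblock (i : ℕ) (hi : i < p + q) :
      permArgs (permArgs x σ) τ i = permArgs x (σ * blockPerm 0 N (by omega) τ) i := by
    simpa using (permArgs_mul_blockPerm (by omega : 0 + (p + q) ≤ N) x σ τ hi).symm
  refine consV_congr hC.1 ?_ fun i hi => ?_
  · congr 1
    · exact hA _ _ fun i hi => hblock i (by omega)
    · exact hB _ _ fun i hi => hblock (p + i) (by omega)
  · exact (permArgs_mul_blockPerm_of_notMem _ x σ τ (by omega)).symm

theorem wedge_nrIns_right_apply {p q m N : ℕ} (hN : p + (q + m) = N) {A B C : Op V}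
    (hA : DependsOn p A) (hB : DependsOn q B) (hC : DependsOn (m + 1) C) (x : ℕ → V) :
    wedge p (q + m) A (nrIns (m + 1) q C B) x =
      ∑ π ∈ monoPerms (threeBlocks N p (p + q)), ((Perm.sign π : ℤˣ) : ℤ) •
        (A (permArgs x π) * C (consV (B fun j => permArgs x π (p + j))
          fun j => permArgs x π (p + q + j))) := by
  rw [wedge_apply hN hA (nrIns_dependsOn hC hB), ← sum_unshuffles_mul_right hN]
  refine Finset.sum_congr rfl fun σ _ => ?_
  rw [nrIns_apply rfl hC hB, Finset.mul_sum, Finset.smul_sum]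
  refine Finset.sum_congr rfl fun τ _ => ?_
  rw [mul_smul_comm, smul_smul, Perm.sign_mul, sign_blockPerm, Units.val_mul]
  congr 2
  · exact hA _ _ fun i hi => (permArgs_mul_blockPerm_of_notMem _ x σ τ (by omega)).symm
  · refine consV_congr hC ?_ fun i hi => ?_
    · exact hB _ _ fun i hi => (permArgs_mul_blockPerm _ x σ τ (by omega)).symm
    · rw [add_assoc]
      exact (permArgs_mul_blockPerm _ x σ τ (by omega)).symm

theorem wedge_nrIns_left_apply {p q m N : ℕ} (hN : p + (q + m) = N) {A B C : Op V}
    (hA : DependsOn p A) (hB : DependsOn q B) (hC : DependsOn (m + 1) C) (x : ℕ → V) :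
    wedge (p + m) q (nrIns (m + 1) p C A) B x =
      ((-1 : ℤˣ) ^ (m * q) : ℤˣ) • ∑ π ∈ monoPerms (threeBlocks N p (p + q)),
        ((Perm.sign π : ℤˣ) : ℤ) • (C (consV (A (permArgs x π))
          fun j => permArgs x π (p + q + j)) * B fun j => permArgs x π (p + j)) := by
  rw [wedge_apply (N := N) (by omega) (nrIns_dependsOn hC hA) hB,
    ← sum_monoPerms_blockSwap hN, ← sum_unshuffles_mul_left (by omega) (by omega),
    Finset.smul_sum]
  refine Finset.sum_congr rfl fun σ _ => ?_
  rw [nrIns_apply rfl hC hA, Finset.sum_mul, Finset.smul_sum, Finset.smul_sum]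
  refine Finset.sum_congr rfl fun τ _ => ?_
  have hr : 0 + (p + m) ≤ N := by omega
  have hsign : (-1 : ℤˣ) ^ (m * q) *
      Perm.sign (σ * blockPerm 0 N hr τ * blockSwap p q m N hN.le) =
        Perm.sign σ * Perm.sign τ := by
    rw [Perm.sign_mul, Perm.sign_mul, blockSwap, sign_blockPerm, sign_blockPerm,
      sign_finRotate_pow, mul_comm, mul_assoc, Int.units_mul_self, mul_one]
  rw [Units.smul_def, smul_smul, ← Units.val_mul, hsign, smul_mul_assoc, smul_smul,
    ← Units.val_mul]
  have hblock (i : ℕ) (hi : i < p + m) :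
      permArgs (permArgs x σ) τ i = permArgs x (σ * blockPerm 0 N hr τ) i := by
    simpa using (permArgs_mul_blockPerm hr x σ τ hi).symm
  congr 2
  · refine consV_congr hC (hA _ _ fun i hi => ?_) fun i hi => ?_
    · rw [hblock i (by omega)]
      refine (permArgs_mul x _ _ (by omega) ?_).symm
      rw [blockSwap_apply hN, if_pos hi]
    · rw [hblock _ (by omega)]
      refine (permArgs_mul x _ _ (by omega) ?_).symm
      rw [blockSwap_apply hN]
      grind
  · refine hB _ _ fun i hi => ?_
    rw [← permArgs_mul_blockPerm_of_notMem hr x σ τ (by omega)]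
    refine (permArgs_mul x _ _ (by omega) ?_).symm
    rw [blockSwap_apply hN]
    grind

theorem wedge_zero_left (p q : ℕ) (B : Op V) : wedge p q 0 B = 0 := by
  funext x
  simp [wedge]

theorem wedge_zero_right (p q : ℕ) (A : Op V) : wedge p q A 0 = 0 := by
  funext x
  simp [wedge]

theorem nrIns_zero_left (q : ℕ) (A B : Op V) : nrIns 0 q A B = 0 := by
  funext x
  simp [nrIns]

end Operations

/-- the insertion identity
`i_{A∧B}C = (−1)^{c(b+1)}(i_A C)∧B + A∧(i_B C)` for alternating `A`, `B` and a
multiderivation `C`. -/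
theorem statement10 (k V : Type*) [Field k] [CharZero k]
    [CommRing V] [Algebra k V]
    (a b c : ℤ) (ha : -1 ≤ a) (hb : -1 ≤ b) (hc : -1 ≤ c)
    (A B : Op V) (hA : MemA k a A) (hB : MemA k b B)
    (C : Op V) (hC : MemADer k c C) :
    nrIns (ar c) (ar (a + b + 1)) C (wedge (ar a) (ar b) A B) =
      (((-1 : ℤˣ) ^ (c * (b + 1)) : ℤˣ) : ℤ) •
          wedge (ar (a + c)) (ar b) (nrIns (ar c) (ar a) C A) B +
        wedge (ar a) (ar (b + c)) A (nrIns (ar c) (ar b) C B) := by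
  rcases hc.eq_or_lt with rfl | hc
  · have h : ar (-1) = 0 := rfl
    rw [h]
    simp only [nrIns_zero_left, wedge_zero_left, wedge_zero_right, smul_zero, add_zero]
  obtain ⟨p, rfl⟩ : ∃ p : ℕ, a = p - 1 := ⟨(a + 1).toNat, by omega⟩
  obtain ⟨q, rfl⟩ : ∃ q : ℕ, b = q - 1 := ⟨(b + 1).toNat, by omega⟩
  obtain ⟨m, rfl⟩ : ∃ m : ℕ, c = m := ⟨c.toNat, by omega⟩
  have hp : ar ((p : ℤ) - 1) = p := by simp [ar]
  have hq : ar ((q : ℤ) - 1) = q := by simp [ar]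
  have hm : ar (m : ℤ) = m + 1 := by simp only [ar]; omega
  have hpq : ar ((p : ℤ) - 1 + (q - 1) + 1) = p + q := by simp only [ar]; omega
  have hpm : ar ((p : ℤ) - 1 + m) = p + m := by simp only [ar]; omega
  have hqm : ar ((q : ℤ) - 1 + m) = q + m := by simp only [ar]; omega
  have hsign : (-1 : ℤˣ) ^ ((m : ℤ) * (q - 1 + 1)) = (-1) ^ (m * q) := by
    rw [sub_add_cancel, ← Nat.cast_mul, zpow_natCast]
  have hA' := hA.1.1
  have hB' := hB.1.1
  have hC' := hC.1
  rw [hp] at hA'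
  rw [hq] at hB'
  rw [hm] at hC'
  rw [hp, hq, hm, hpq, hpm, hqm, hsign]
  funext x
  rw [Pi.add_apply, Pi.smul_apply, nrIns_wedge_apply rfl hA' hB' hC',
    wedge_nrIns_left_apply rfl hA' hB' hC'.1, wedge_nrIns_right_apply rfl hA' hB' hC'.1,
    ← Units.smul_def, smul_smul, Int.units_mul_self, one_smul, ← Finset.sum_add_distrib]
  refine Finset.sum_congr rfl fun π _ => ?_
  rw [← smul_add, hC.2.2 (by omega)]
  congr 1
  ring

end JacobiRevisited
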